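/- Lemma 6.1: Suppose 0 < ε < 1/8. Then there is a constant C (depending only on ε) such that for all a, b, c, d ∈ ℝ, ∫_ℝ du / ( |u−a|^{2ε} |u−b|^{2ε} |u−c|^{2ε} |u−d|^{2ε} ⟨u⟩^{1−4ε} ) ≤ C. -/

import Mathlib

open MeasureTheory
open scoped ENNReal

noncomputable section

/-- Japanese bracket `⟨x⟩ = √(1+x²)`. -/
def jap (x : ℝ) : ℝ := Real.sqrt (1 + x ^ 2)

/-- Integrable majorant of `|v| ^ (-s)`: the singularity near `0` and a bracket tail. -/
def singularMajorant (s p v : ℝ) : ℝ :=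
  (Set.Ioo (-1 : ℝ) 1).indicator (fun v => |v| ^ (-s)) v + 2 * jap v ^ (-p)

lemma one_le_jap (u : ℝ) : 1 ≤ jap u := by
  unfold jap
  rw [Real.one_le_sqrt]
  nlinarith [sq_nonneg u]

lemma integrable_jap_rpow_neg {p : ℝ} (hp : 1 < p) : Integrable fun u : ℝ => jap u ^ (-p) := by
  have h := integrable_rpow_neg_one_add_norm_sq (E := ℝ) (μ := volume) (r := p) (by simpa using hp)
  refine h.congr (Filter.Eventually.of_forall fun u => ?_)
  simp only [jap, Real.norm_eq_abs, sq_abs, Real.sqrt_eq_rpow]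
  rw [← Real.rpow_mul (by positivity)]
  congr 1
  ring

lemma integrableOn_abs_rpow_neg {s : ℝ} (hs : s < 1) :
    IntegrableOn (fun v : ℝ => |v| ^ (-s)) (Set.Ioo (-1) 1) := by
  have hpos : IntervalIntegrable (fun v : ℝ => |v| ^ (-s)) volume 0 1 := by
    refine (intervalIntegral.intervalIntegrable_rpow' (a := 0) (b := 1) (r := -s)
      (by linarith)).congr fun v hv => ?_
    rw [Set.uIoc_of_le zero_le_one] at hv
    simp only [abs_of_pos hv.1]
  have hneg : IntervalIntegrable (fun v : ℝ => |v| ^ (-s)) volume (-1) 0 := by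
    have h := hpos.comp_sub_left 0
    simp only [zero_sub, abs_neg, neg_zero] at h
    simpa using h.symm
  have h := hneg.trans hpos
  rw [intervalIntegrable_iff_integrableOn_Ioo_of_le (by norm_num)] at h
  exact h

lemma integrable_singularMajorant {s p : ℝ} (hs : s < 1) (hp : 1 < p) :
    Integrable (singularMajorant s p) :=
  ((integrable_indicator_iff measurableSet_Ioo).2 (integrableOn_abs_rpow_neg hs)).add
    ((integrable_jap_rpow_neg hp).const_mul 2)

lemma singularMajorant_nonneg (s p v : ℝ) : 0 ≤ singularMajorant s p v := by
  have h := one_le_jap v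
  exact add_nonneg (Set.indicator_nonneg (fun _ _ => by positivity) _) (by positivity)

lemma rpow_neg_mul_rpow_neg_le_add {x y s t : ℝ} (hx : 0 < x) (hy : 0 < y) (hs : 0 ≤ s)
    (ht : 0 ≤ t) : x ^ (-s) * y ^ (-t) ≤ x ^ (-(s + t)) + y ^ (-(s + t)) := by
  have hx' : 0 ≤ x ^ (-(s + t)) := by positivity
  have hy' : 0 ≤ y ^ (-(s + t)) := by positivity
  rcases le_total x y with h | h
  · have : y ^ (-t) ≤ x ^ (-t) := Real.rpow_le_rpow_of_nonpos hx h (by linarith)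
    calc x ^ (-s) * y ^ (-t) ≤ x ^ (-s) * x ^ (-t) := by gcongr
      _ = x ^ (-(s + t)) := by rw [← Real.rpow_add hx]; congr 1; ring
      _ ≤ _ := by linarith
  · have : x ^ (-s) ≤ y ^ (-s) := Real.rpow_le_rpow_of_nonpos hy h (by linarith)
    calc x ^ (-s) * y ^ (-t) ≤ y ^ (-s) * y ^ (-t) := by gcongr
      _ = y ^ (-(s + t)) := by rw [← Real.rpow_add hy]; congr 1; ring
      _ ≤ _ := by linarith

lemma abs_rpow_neg_le_two_mul_jap {s v : ℝ} (hs0 : 0 ≤ s) (hs : s ≤ 1) (hv : 1 ≤ |v|) :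
    |v| ^ (-s) ≤ 2 * jap v ^ (-s) := by
  have hj : jap v ≤ 2 * |v| := by
    unfold jap
    rw [Real.sqrt_le_left (by positivity)]
    nlinarith [sq_abs v]
  have hj0 : 0 < jap v := one_pos.trans_le (one_le_jap v)
  have hv0 : 0 < |v| := one_pos.trans_le hv
  have h : (2 * |v|) ^ (-s) ≤ jap v ^ (-s) := Real.rpow_le_rpow_of_nonpos hj0 hj (by linarith)
  rw [Real.mul_rpow zero_le_two hv0.le] at h
  have h2 : (2 : ℝ)⁻¹ ≤ 2 ^ (-s) := by
    rw [← Real.rpow_neg_one]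
    exact Real.rpow_le_rpow_of_exponent_le one_le_two (by linarith)
  have h3 : 0 ≤ |v| ^ (-s) := by positivity
  nlinarith

lemma abs_rpow_neg_mul_jap_le {s t : ℝ} (hs0 : 0 ≤ s) (hs : s ≤ 1) (ht : 0 ≤ t) (u v : ℝ) :
    |v| ^ (-s) * jap u ^ (-t) ≤ singularMajorant s (s + t) v + 2 * jap u ^ (-(s + t)) := by
  have hu := one_le_jap u
  have hv := one_le_jap v
  have h1 : 0 ≤ jap u ^ (-(s + t)) := by positivity
  have h2 : 0 ≤ jap v ^ (-(s + t)) := by positivity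
  unfold singularMajorant
  by_cases h : v ∈ Set.Ioo (-1 : ℝ) 1
  · rw [Set.indicator_of_mem h]
    have := mul_le_of_le_one_right (a := |v| ^ (-s)) (by positivity)
      (Real.rpow_le_one_of_one_le_of_nonpos hu (by linarith : -t ≤ 0))
    linarith
  · rw [Set.indicator_of_notMem h]
    have hv1 : 1 ≤ |v| := by
      by_contra! hlt
      exact h (abs_lt.1 hlt)
    have h3 := mul_le_mul_of_nonneg_right (abs_rpow_neg_le_two_mul_jap hs0 hs hv1)
      (by positivity : 0 ≤ jap u ^ (-t))
    have h4 := rpow_neg_mul_rpow_neg_le_add (x := jap v) (y := jap u)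
      (by linarith) (by linarith) hs0 ht
    linarith

lemma mul_rpow_neg_le_arith_mean4 {x y z w : ℝ} (hx : 0 ≤ x) (hy : 0 ≤ y) (hz : 0 ≤ z)
    (hw : 0 ≤ w) (r : ℝ) :
    x ^ (-r) * y ^ (-r) * z ^ (-r) * w ^ (-r) ≤
      (x ^ (-(4 * r)) + y ^ (-(4 * r)) + z ^ (-(4 * r)) + w ^ (-(4 * r))) / 4 := by
  have key : ∀ {q : ℝ}, 0 ≤ q → (q ^ (-(4 * r))) ^ (1 / 4 : ℝ) = q ^ (-r) := fun hq => by
    rw [← Real.rpow_mul hq]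
    congr 1
    ring
  have h := Real.geom_mean_le_arith_mean4_weighted (w₁ := 1 / 4) (w₂ := 1 / 4) (w₃ := 1 / 4)
    (w₄ := 1 / 4) (p₁ := x ^ (-(4 * r))) (p₂ := y ^ (-(4 * r))) (p₃ := z ^ (-(4 * r)))
    (p₄ := w ^ (-(4 * r))) (by norm_num) (by norm_num) (by norm_num) (by norm_num)
    (by positivity) (by positivity) (by positivity) (by positivity) (by norm_num)
  rw [key hx, key hy, key hz, key hw] at h
  linarith

/-- **Lemma 6.1**: for `0 < ε < 1/8`, the integral
`∫ du / (|u-a|^{2ε} |u-b|^{2ε} |u-c|^{2ε} |u-d|^{2ε} ⟨u⟩^{1-4ε})`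
is bounded uniformly in `a, b, c, d`. -/
theorem four_singularity_integral_bound (ε : ℝ) (hε0 : 0 < ε) (hε : ε < 1/8) :
    ∃ C : ℝ, ∀ a b c d : ℝ,
      (∫⁻ u : ℝ, (ENNReal.ofReal
          (|u - a| ^ (2*ε) * |u - b| ^ (2*ε) * |u - c| ^ (2*ε) * |u - d| ^ (2*ε) *
            jap u ^ (1 - 4*ε)))⁻¹)
        ≤ ENNReal.ofReal C := by
  have hG : Integrable (singularMajorant (8 * ε) (1 + 4 * ε)) :=
    integrable_singularMajorant (by linarith) (by linarith)
  have hH : Integrable fun u : ℝ => 2 * jap u ^ (-(1 + 4 * ε)) :=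
    (integrable_jap_rpow_neg (by linarith)).const_mul 2
  set G := singularMajorant (8 * ε) (1 + 4 * ε)
  refine ⟨(∫ v, G v) + ∫ u, 2 * jap u ^ (-(1 + 4 * ε)), fun a b c d => ?_⟩
  have hGs : ∀ e, Integrable fun u => G (u - e) := fun e => hG.comp_sub_right e
  have hab : Integrable fun u => G (u - a) + G (u - b) := (hGs a).add (hGs b)
  have habc : Integrable fun u => G (u - a) + G (u - b) + G (u - c) := hab.add (hGs c)
  have hF : Integrable fun u => (G (u - a) + G (u - b) + G (u - c) + G (u - d)) / 4 :=
    (habc.add (hGs d)).div_const 4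
  have hFH : Integrable fun u => (G (u - a) + G (u - b) + G (u - c) + G (u - d)) / 4
      + 2 * jap u ^ (-(1 + 4 * ε)) := hF.add hH
  have hint : ∫ u, ((G (u - a) + G (u - b) + G (u - c) + G (u - d)) / 4
      + 2 * jap u ^ (-(1 + 4 * ε))) = (∫ v, G v) + ∫ u, 2 * jap u ^ (-(1 + 4 * ε)) := by
    rw [integral_add hF hH, integral_div, integral_add habc (hGs d), integral_add hab (hGs c),
      integral_add (hGs a) (hGs b)]
    simp only [integral_sub_right_eq_self]
    ring
  have hG0 : ∀ v, 0 ≤ G v := singularMajorant_nonneg _ _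
  rw [← hint, ofReal_integral_eq_lintegral_ofReal hFH
    (Filter.Eventually.of_forall fun u => by
      have h1 := one_le_jap u
      have h2 := hG0 (u - a)
      have h3 := hG0 (u - b)
      have h4 := hG0 (u - c)
      have h5 := hG0 (u - d)
      simp only [Pi.zero_apply]
      positivity)]
  refine lintegral_mono_ae ?_
  filter_upwards [Measure.ae_ne volume a, Measure.ae_ne volume b, Measure.ae_ne volume c,
    Measure.ae_ne volume d] with u ha hb hc hd
  have ha : 0 < |u - a| := abs_pos.2 (sub_ne_zero.2 ha)
  have hb : 0 < |u - b| := abs_pos.2 (sub_ne_zero.2 hb)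
  have hc : 0 < |u - c| := abs_pos.2 (sub_ne_zero.2 hc)
  have hd : 0 < |u - d| := abs_pos.2 (sub_ne_zero.2 hd)
  have hj : 0 < jap u := one_pos.trans_le (one_le_jap u)
  rw [← ENNReal.ofReal_inv_of_pos (by positivity)]
  refine ENNReal.ofReal_le_ofReal ?_
  simp only [mul_inv, ← Real.rpow_neg (abs_nonneg _), ← Real.rpow_neg hj.le]
  have hmean := mul_le_mul_of_nonneg_right
    (mul_rpow_neg_le_arith_mean4 ha.le hb.le hc.le hd.le (2 * ε))
    (by positivity : 0 ≤ jap u ^ (-(1 - 4 * ε)))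
  rw [show 4 * (2 * ε) = 8 * ε by ring] at hmean
  have hbound : ∀ e, |u - e| ^ (-(8 * ε)) * jap u ^ (-(1 - 4 * ε)) ≤
      G (u - e) + 2 * jap u ^ (-(1 + 4 * ε)) := fun e => by
    have h := abs_rpow_neg_mul_jap_le (s := 8 * ε) (t := 1 - 4 * ε) (by linarith) (by linarith)
      (by linarith) u (u - e)
    rwa [show 8 * ε + (1 - 4 * ε) = 1 + 4 * ε by ring] at h
  linarith [hbound a, hbound b, hbound c, hbound d]

end
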